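/- Let n ≥ 1, t, p ∈ (0,∞), q ∈ (1,∞), r ∈ (1,∞) and −n/q < α < n(1 − 1/q). Then the Hardy–Littlewood maximal operator is bounded on the non-homogeneous Herz-slice space: there is a constant C > 0, independent of f, such that for every locally integrable f : ℝⁿ → ℂ, ‖Mf‖_{(KE^{α,p}_{q,r})_t} ≤ C ‖f‖_{(KE^{α,p}_{q,r})_t}. -/

import Mathlib

open MeasureTheory Metric Set ENNReal
open scoped NNReal

noncomputable section

abbrev En (n : ℕ) : Type := EuclideanSpace ℝ (Fin n)

/-- Slice norm `‖f‖_{(E_r^q)_t}` for `ℝ≥0∞`-valued functions. -/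
def sliceNorm (n : ℕ) (t r : ℝ) (q : ℝ≥0∞) (g : En n → ℝ≥0∞) : ℝ≥0∞ :=
  if q = ∞ then
    essSup (fun x => ((volume (ball x t))⁻¹ * ∫⁻ y in ball x t, g y ^ r) ^ (1 / r)) volume
  else
    (∫⁻ x, (((volume (ball x t))⁻¹ * ∫⁻ y in ball x t, g y ^ r) ^ (1 / r)) ^ q.toReal) ^ (1 / q.toReal)

/-- Slice norm of a complex-valued function. -/
def sliceNormC (n : ℕ) (t r : ℝ) (q : ℝ≥0∞) (f : En n → ℂ) : ℝ≥0∞ :=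
  sliceNorm n t r q fun y => (‖f y‖₊ : ℝ≥0∞)

/-- The ball `B_k = {x : |x| ≤ 2^k}`. -/
def ballZ (n : ℕ) (k : ℤ) : Set (En n) := closedBall 0 ((2 : ℝ) ^ k)

/-- The shell `S_k = B_k \ B_{k-1}`. -/
def shell (n : ℕ) (k : ℤ) : Set (En n) := ballZ n k \ ballZ n (k - 1)

/-- Homogeneous Herz-slice norm of an `ℝ≥0∞`-valued function. -/
def herzHom (n : ℕ) (t r : ℝ) (q : ℝ≥0∞) (α : ℝ) (p : ℝ≥0∞) (g : En n → ℝ≥0∞) : ℝ≥0∞ :=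
  if p = ∞ then
    ⨆ k : ℤ, (2 : ℝ≥0∞) ^ ((k : ℝ) * α) * sliceNorm n t r q ((shell n k).indicator g)
  else
    (∑' k : ℤ, ((2 : ℝ≥0∞) ^ ((k : ℝ) * α) * sliceNorm n t r q ((shell n k).indicator g)) ^ p.toReal) ^ (1 / p.toReal)

/-- Homogeneous Herz-slice norm of a complex-valued function. -/
def herzHomC (n : ℕ) (t r : ℝ) (q : ℝ≥0∞) (α : ℝ) (p : ℝ≥0∞) (f : En n → ℂ) : ℝ≥0∞ :=
  herzHom n t r q α p fun y => (‖f y‖₊ : ℝ≥0∞)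

/-- The `k`-th piece in the non-homogeneous decomposition: `B_0` for `k = 0`, `S_k` for `k ≥ 1`. -/
def pieceN (n : ℕ) (k : ℕ) : Set (En n) := if k = 0 then ballZ n 0 else shell n k

/-- Non-homogeneous Herz-slice norm of an `ℝ≥0∞`-valued function. -/
def herzNonHom (n : ℕ) (t r : ℝ) (q : ℝ≥0∞) (α : ℝ) (p : ℝ≥0∞) (g : En n → ℝ≥0∞) : ℝ≥0∞ :=
  if p = ∞ then
    ⨆ k : ℕ, (2 : ℝ≥0∞) ^ ((k : ℝ) * α) * sliceNorm n t r q ((pieceN n k).indicator g)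
  else
    (∑' k : ℕ, ((2 : ℝ≥0∞) ^ ((k : ℝ) * α) * sliceNorm n t r q ((pieceN n k).indicator g)) ^ p.toReal) ^ (1 / p.toReal)

/-- Non-homogeneous Herz-slice norm of a complex-valued function. -/
def herzNonHomC (n : ℕ) (t r : ℝ) (q : ℝ≥0∞) (α : ℝ) (p : ℝ≥0∞) (f : En n → ℂ) : ℝ≥0∞ :=
  herzNonHom n t r q α p fun y => (‖f y‖₊ : ℝ≥0∞)

/-- Hardy–Littlewood maximal operator. -/
def maximal (n : ℕ) (f : En n → ℂ) (x : En n) : ℝ≥0∞ :=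
  ⨆ (ρ : ℝ) (_ : 0 < ρ), (volume (ball x ρ))⁻¹ * ∫⁻ y in ball x ρ, (‖f y‖₊ : ℝ≥0∞)


/-- The maximal operator on `ℝ≥0∞`-valued functions. -/
def MM (n : ℕ) (g : En n → ℝ≥0∞) (x : En n) : ℝ≥0∞ :=
  ⨆ (ρ : ℝ) (_ : 0 < ρ), (volume (ball x ρ))⁻¹ * ∫⁻ y in ball x ρ, g y

lemma vol_ball (n : ℕ) (x : En n) {ρ : ℝ} (hρ : 0 < ρ) :
    volume (ball x ρ) = ENNReal.ofReal (ρ ^ n) * volume (ball (0 : En n) 1) := by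
  rw [Measure.addHaar_ball_of_pos volume x hρ, finrank_euclideanSpace_fin]

lemma vol_closedBall (n : ℕ) (x : En n) {ρ : ℝ} (hρ : 0 < ρ) :
    volume (closedBall x ρ) = ENNReal.ofReal (ρ ^ n) * volume (ball (0 : En n) 1) := by
  rw [Measure.addHaar_closedBall volume x hρ.le, finrank_euclideanSpace_fin]

lemma vol_ball_ne_zero (n : ℕ) (x : En n) {ρ : ℝ} (hρ : 0 < ρ) : volume (ball x ρ) ≠ 0 :=
  (measure_ball_pos volume x hρ).ne'

lemma vol_ball_ne_top (n : ℕ) (x : En n) (ρ : ℝ) : volume (ball x ρ) ≠ ∞ :=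
  measure_ball_lt_top.ne

lemma meas_ball_set (n : ℕ) (s : ℝ) : MeasurableSet {z : En n × En n | dist z.2 z.1 < s} :=
  measurableSet_lt (measurable_snd.dist measurable_fst) measurable_const

lemma meas_ballInt (n : ℕ) (s : ℝ) (g : En n → ℝ≥0∞) (hg : Measurable g) :
    Measurable fun x : En n => ∫⁻ y in ball x s, g y := by
  have : (fun x : En n => ∫⁻ y in ball x s, g y) =
      fun x => ∫⁻ y, ({z : En n × En n | dist z.2 z.1 < s}.indicator (fun z => g z.2)) (x, y) := by
    ext x
    rw [← lintegral_indicator measurableSet_ball]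
    rfl
  rw [this]
  exact Measurable.lintegral_prod_right' ((hg.comp measurable_snd).indicator (meas_ball_set n s))

lemma MM_rat (n : ℕ) (g : En n → ℝ≥0∞) (x : En n) :
    MM n g x = ⨆ (a : ℚ) (_ : 0 < a), (volume (ball x (a : ℝ)))⁻¹ * ∫⁻ y in ball x (a : ℝ), g y := by
  apply le_antisymm
  · refine iSup₂_le fun ρ hρ => ?_
    have hU : ball x ρ = ⋃ i : {a : ℚ // 0 < a ∧ (a : ℝ) < ρ}, ball x ((i : ℚ) : ℝ) := by
      ext y
      simp only [mem_ball, mem_iUnion, Subtype.exists]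
      constructor
      · intro h
        obtain ⟨a, ha1, ha2⟩ := exists_rat_btwn h
        refine ⟨a, ⟨?_, ha2⟩, ha1⟩
        have : (0 : ℝ) < a := dist_nonneg.trans_lt ha1
        exact_mod_cast this
      · rintro ⟨a, ⟨_, ha2⟩, ha1⟩
        exact ha1.trans ha2
    have hd : Directed (· ⊆ ·) fun i : {a : ℚ // 0 < a ∧ (a : ℝ) < ρ} => ball x ((i : ℚ) : ℝ) := by
      intro i j
      rcases le_total i.1 j.1 with h | h
      · exact ⟨j, ball_subset_ball (by exact_mod_cast h), le_rfl⟩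
      · exact ⟨i, le_rfl, ball_subset_ball (by exact_mod_cast h)⟩
    have : ∫⁻ y in ball x ρ, g y = ⨆ i : {a : ℚ // 0 < a ∧ (a : ℝ) < ρ}, ∫⁻ y in ball x ((i : ℚ) : ℝ), g y := by
      conv_lhs => rw [hU]
      rw [setLIntegral_iUnion_of_directed _ hd]
    rw [this, ENNReal.mul_iSup]
    refine iSup_le fun i => ?_
    refine le_trans ?_ (le_iSup₂ (f := fun (a : ℚ) (_ : 0 < a) => (volume (ball x (a : ℝ)))⁻¹ * ∫⁻ y in ball x (a : ℝ), g y) i.1 i.2.1)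
    gcongr
    exact i.2.2.le
  · refine iSup₂_le fun a ha => ?_
    exact le_iSup₂ (f := fun (ρ : ℝ) (_ : 0 < ρ) => (volume (ball x ρ))⁻¹ * ∫⁻ y in ball x ρ, g y) (a : ℝ) (by exact_mod_cast ha)

lemma meas_MM (n : ℕ) (g : En n → ℝ≥0∞) (hg : Measurable g) : Measurable (MM n g) := by
  have : MM n g = fun x => ⨆ (a : ℚ) (_ : 0 < a), (volume (ball x (a : ℝ)))⁻¹ * ∫⁻ y in ball x (a : ℝ), g y :=
    funext (MM_rat n g)
  rw [this]
  refine Measurable.iSup fun a => Measurable.iSup fun ha => ?_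
  have h2 : ∀ x : En n, volume (ball x (a : ℝ)) = volume (ball (0 : En n) (a : ℝ)) := fun x =>
    Measure.addHaar_ball_center _ _ _
  simp_rw [h2]
  exact (meas_ballInt n a g hg).const_mul _

lemma le_MM (n : ℕ) (g : En n → ℝ≥0∞) (x : En n) {ρ : ℝ} (hρ : 0 < ρ) :
    (∫⁻ y in ball x ρ, g y) ≤ volume (ball x ρ) * MM n g x := by
  have : (volume (ball x ρ))⁻¹ * ∫⁻ y in ball x ρ, g y ≤ MM n g x :=
    le_iSup₂ (f := fun (ρ : ℝ) (_ : 0 < ρ) => (volume (ball x ρ))⁻¹ * ∫⁻ y in ball x ρ, g y) ρ hρ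
  calc _ = volume (ball x ρ) * ((volume (ball x ρ))⁻¹ * ∫⁻ y in ball x ρ, g y) := by
        rw [← mul_assoc, ENNReal.mul_inv_cancel (vol_ball_ne_zero n x hρ) (vol_ball_ne_top n x ρ), one_mul]
    _ ≤ _ := by gcongr

lemma MM_le (n : ℕ) (g : En n → ℝ≥0∞) (x : En n) (c : ℝ≥0∞)
    (h : ∀ ρ : ℝ, 0 < ρ → (∫⁻ y in ball x ρ, g y) ≤ volume (ball x ρ) * c) : MM n g x ≤ c := by
  refine iSup₂_le fun ρ hρ => ?_
  calc _ ≤ (volume (ball x ρ))⁻¹ * (volume (ball x ρ) * c) := by gcongr; exact h ρ hρ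
    _ = c := by
        rw [← mul_assoc, ENNReal.inv_mul_cancel (vol_ball_ne_zero n x hρ) (vol_ball_ne_top n x ρ), one_mul]

lemma weak_type_trunc (n : ℕ) (g : En n → ℝ≥0∞) (l : ℝ≥0∞) (R : ℝ) :
    l * volume {x : En n | ∃ ρ : ℝ, 0 < ρ ∧ ρ ≤ R ∧ l * volume (ball x ρ) < ∫⁻ y in ball x ρ, g y} ≤
      ENNReal.ofReal (5 ^ n) * ∫⁻ y, g y := by
  set A := {x : En n | ∃ ρ : ℝ, 0 < ρ ∧ ρ ≤ R ∧ l * volume (ball x ρ) < ∫⁻ y in ball x ρ, g y} with hA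
  have : ∀ x : En n, ∃ ρ : ℝ, x ∈ A → 0 < ρ ∧ ρ ≤ R ∧ l * volume (ball x ρ) < ∫⁻ y in ball x ρ, g y := by
    intro x
    by_cases hx : x ∈ A
    · obtain ⟨ρ, h⟩ := hx
      exact ⟨ρ, fun _ => h⟩
    · exact ⟨0, fun h => absurd h hx⟩
  choose ρ hρ using this
  obtain ⟨u, huA, hud, huc⟩ := Vitali.exists_disjoint_subfamily_covering_enlargement_closedBall
    A (fun x => x) ρ R (fun a ha => (hρ a ha).2.1) 5 (by norm_num)
  have hcount : u.Countable := hud.countable_of_nonempty_interior fun a ha =>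
    (nonempty_ball.2 (hρ a (huA ha)).1).mono ball_subset_interior_closedBall
  have hdb : u.PairwiseDisjoint fun a => ball a (ρ a) :=
    hud.mono fun a => ball_subset_closedBall
  have hsub : A ⊆ ⋃ b ∈ u, closedBall b (5 * ρ b) := by
    intro a ha
    obtain ⟨b, hb, hab⟩ := huc a ha
    exact mem_iUnion₂.2 ⟨b, hb, hab (mem_closedBall_self (hρ a ha).1.le)⟩
  have : Countable u := hcount.to_subtype
  calc l * volume A ≤ l * ∑' b : u, volume (closedBall (b : En n) (5 * ρ b)) := by
        gcongr
        exact (measure_mono hsub).trans (measure_biUnion_le _ hcount _)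
    _ = ∑' b : u, ENNReal.ofReal (5 ^ n) * (l * volume (ball (b : En n) (ρ b))) := by
        rw [← ENNReal.tsum_mul_left]
        congr 1; ext b
        have hb := (hρ b (huA b.2)).1
        rw [vol_closedBall n _ (by positivity : 0 < 5 * ρ b), vol_ball n _ hb, mul_pow,
          ENNReal.ofReal_mul (by positivity)]
        ring
    _ ≤ ∑' b : u, ENNReal.ofReal (5 ^ n) * (∫⁻ y in ball (b : En n) (ρ b), g y) := by
        gcongr with b
        exact (hρ b (huA b.2)).2.2.le
    _ = ENNReal.ofReal (5 ^ n) * ∫⁻ y in ⋃ b ∈ u, ball b (ρ b), g y := by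
        rw [ENNReal.tsum_mul_left, lintegral_biUnion hcount (fun _ _ => measurableSet_ball) hdb]
    _ ≤ _ := by gcongr; exact Measure.restrict_le_self

lemma weak_type (n : ℕ) (g : En n → ℝ≥0∞) (l : ℝ≥0∞) :
    l * volume {x : En n | l < MM n g x} ≤ ENNReal.ofReal (5 ^ n) * ∫⁻ y, g y := by
  have hsub : {x : En n | l < MM n g x} ⊆ ⋃ N : ℕ,
      {x : En n | ∃ ρ : ℝ, 0 < ρ ∧ ρ ≤ N ∧ l * volume (ball x ρ) < ∫⁻ y in ball x ρ, g y} := by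
    intro x hx
    simp only [mem_ofPred_eq, MM, lt_iSup_iff] at hx
    obtain ⟨ρ, hρ, h⟩ := hx
    obtain ⟨N, hN⟩ := exists_nat_ge ρ
    refine mem_iUnion.2 ⟨N, ρ, hρ, hN, ?_⟩
    rw [mul_comm, ← div_eq_mul_inv] at h
    exact (ENNReal.lt_div_iff_mul_lt (Or.inl (vol_ball_ne_zero n x hρ)) (Or.inl (vol_ball_ne_top n x ρ))).1 h
  have hmono : Monotone fun N : ℕ =>
      {x : En n | ∃ ρ : ℝ, 0 < ρ ∧ ρ ≤ N ∧ l * volume (ball x ρ) < ∫⁻ y in ball x ρ, g y} := by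
    rintro a b hab x ⟨ρ, h1, h2, h3⟩
    exact ⟨ρ, h1, h2.trans (by exact_mod_cast hab), h3⟩
  calc _ ≤ l * volume (⋃ N : ℕ, {x : En n | ∃ ρ : ℝ, 0 < ρ ∧ ρ ≤ N ∧ l * volume (ball x ρ) < ∫⁻ y in ball x ρ, g y}) := by
        gcongr
    _ ≤ _ := by
        rw [hmono.measure_iUnion, ENNReal.mul_iSup]
        exact iSup_le fun N => weak_type_trunc n g l N

lemma layer_aux (a : ℝ≥0∞) {s : ℝ} (hs : 0 < s) :
    a ^ s = ENNReal.ofReal s * ∫⁻ l in Ioi (0 : ℝ), (if ENNReal.ofReal l < a then 1 else 0) * ENNReal.ofReal (l ^ (s - 1)) := by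
  have key : ∀ b : ℝ, 0 ≤ b → ENNReal.ofReal b ^ s = ENNReal.ofReal s * ∫⁻ l in Ioi (0 : ℝ), (if ENNReal.ofReal l < ENNReal.ofReal b then 1 else 0) * ENNReal.ofReal (l ^ (s - 1)) := by
    intro b hb
    have := lintegral_rpow_eq_lintegral_meas_lt_mul (μ := Measure.dirac (0 : ℝ)) (f := fun _ => b)
      (Filter.Eventually.of_forall fun _ => hb) aemeasurable_const hs
    simp only [lintegral_const, measure_univ, mul_one] at this
    rw [ENNReal.ofReal_rpow_of_nonneg hb hs.le, this]
    congr 1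
    refine setLIntegral_congr_fun measurableSet_Ioi fun l hl => ?_
    congr 1
    have hl' : (0 : ℝ) < l := hl
    by_cases h : l < b
    · simp [h, (ENNReal.ofReal_lt_ofReal_iff_of_nonneg hl'.le)]
    · simp [h, (ENNReal.ofReal_lt_ofReal_iff_of_nonneg hl'.le)]
  by_cases ha : a = ∞
  · subst ha
    rw [ENNReal.top_rpow_of_pos hs]
    symm
    apply ENNReal.eq_top_of_forall_nnreal_le
    intro c
    have h1 := key ((c : ℝ) ^ (1 / s)) (by positivity)
    rw [ENNReal.ofReal_rpow_of_nonneg (by positivity) hs.le, ← Real.rpow_mul (NNReal.coe_nonneg c), one_div, inv_mul_cancel₀ hs.ne', Real.rpow_one, ENNReal.ofReal_coe_nnreal] at h1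
    rw [h1]
    gcongr with l
    split_ifs <;> simp_all
  · rw [← ENNReal.ofReal_toReal ha]
    exact key _ ENNReal.toReal_nonneg

lemma MM_split (n : ℕ) (g : En n → ℝ≥0∞) (c : ℝ≥0∞) (x : En n) :
    MM n g x ≤ MM n ({y | c < g y}.indicator g) x + c := by
  apply MM_le
  intro ρ hρ
  calc (∫⁻ y in ball x ρ, g y) ≤ ∫⁻ y in ball x ρ, ({y | c < g y}.indicator g y + c) := by
        gcongr with y
        by_cases h : c < g y
        · simp [h]
        · simp [h, not_lt.1 h]
    _ = (∫⁻ y in ball x ρ, {y | c < g y}.indicator g y) + volume (ball x ρ) * c := by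
        rw [lintegral_add_right _ measurable_const]
        simp [mul_comm]
    _ ≤ _ := by
        rw [mul_add]
        gcongr
        exact le_MM n _ x hρ

lemma HL_strong (n : ℕ) {s : ℝ} (hs : 1 < s) :
    ∃ C : ℝ≥0∞, C ≠ ∞ ∧ ∀ g : En n → ℝ≥0∞, Measurable g →
      ∫⁻ x, MM n g x ^ s ≤ C * ∫⁻ x, g x ^ s := by
  refine ⟨ENNReal.ofReal s * (ENNReal.ofReal (5 ^ n) * 2 * (2 ^ (s-1) * (ENNReal.ofReal (s - 1))⁻¹)), ?_, ?_⟩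
  · have : (ENNReal.ofReal (s - 1))⁻¹ ≠ ∞ := by
      rw [ENNReal.inv_ne_top]; simpa using hs
    have h2 : (2 : ℝ≥0∞) ^ (s - 1) ≠ ∞ := ENNReal.rpow_ne_top_of_nonneg (by linarith) (by simp)
    finiteness
  intro g hg
  have hM := meas_MM n g hg
  have hs0 : 0 < s := by linarith
  have hs1 : 0 < s - 1 := by linarith
  have hw : ∀ l : ℝ, 0 < l → volume {x : En n | ENNReal.ofReal l < MM n g x} * ENNReal.ofReal (l ^ (s - 1)) ≤
      ENNReal.ofReal (5 ^ n) * 2 * ∫⁻ y, g y * ((if ENNReal.ofReal l < 2 * g y then 1 else 0) * ENNReal.ofReal (l ^ (s - 1 - 1))) := by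
    intro l hl
    set c := ENNReal.ofReal (l / 2)
    have hc : c + c = ENNReal.ofReal l := by
      rw [← ENNReal.ofReal_add (by positivity) (by positivity)]; congr 1; ring
    have h1 : {x : En n | ENNReal.ofReal l < MM n g x} ⊆ {x | c < MM n ({y | c < g y}.indicator g) x} := by
      intro x hx
      simp only [mem_ofPred_eq] at hx ⊢
      by_contra hcon
      push Not at hcon
      have := (MM_split n g c x).trans (add_le_add_left hcon c)
      rw [hc] at this
      exact absurd hx (not_lt.2 this)
    have h2 := weak_type n ({y | c < g y}.indicator g) c
    have h3 : ENNReal.ofReal (l ^ (s - 1)) = c * (2 * ENNReal.ofReal (l ^ (s - 1 - 1))) := by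
      have : (2 : ℝ≥0∞) = ENNReal.ofReal 2 := by simp
      rw [this, ← ENNReal.ofReal_mul (by norm_num), ← ENNReal.ofReal_mul (by positivity)]
      congr 1
      rw [Real.rpow_sub_one hl.ne' (s - 1)]
      field_simp
    calc _ ≤ volume {x | c < MM n ({y | c < g y}.indicator g) x} * ENNReal.ofReal (l ^ (s - 1)) := by gcongr
      _ = (c * volume {x | c < MM n ({y | c < g y}.indicator g) x}) * (2 * ENNReal.ofReal (l ^ (s - 1 - 1))) := by
          rw [h3]; ring
      _ ≤ (ENNReal.ofReal (5 ^ n) * ∫⁻ y, {y | c < g y}.indicator g y) * (2 * ENNReal.ofReal (l ^ (s - 1 - 1))) := by gcongr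
      _ = ENNReal.ofReal (5 ^ n) * 2 * ((∫⁻ y, {y | c < g y}.indicator g y) * ENNReal.ofReal (l ^ (s - 1 - 1))) := by ring
      _ = _ := by
          rw [← lintegral_mul_const' _ _ ENNReal.ofReal_ne_top]
          congr 2
          ext y
          have : (c < g y) ↔ (ENNReal.ofReal l < 2 * g y) := by
            rw [← hc, ← two_mul]
            exact (ENNReal.mul_lt_mul_iff_right (by simp) (by simp)).symm
          by_cases h : c < g y
          · simp [h, this.1 h]
          · have h' := fun h'' => h (this.2 h'')
            simp only [mem_ofPred_eq, h, not_false_eq_true, indicator_of_notMem, zero_mul, if_neg h', mul_zero]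
  calc ∫⁻ x, MM n g x ^ s
      = ENNReal.ofReal s * ∫⁻ x, ∫⁻ l in Ioi (0 : ℝ), (if ENNReal.ofReal l < MM n g x then 1 else 0) * ENNReal.ofReal (l ^ (s - 1)) := by
        rw [← lintegral_const_mul' _ _ ENNReal.ofReal_ne_top]
        congr 1; ext x
        exact layer_aux _ hs0
    _ = ENNReal.ofReal s * ∫⁻ l in Ioi (0 : ℝ), ∫⁻ x, (if ENNReal.ofReal l < MM n g x then 1 else 0) * ENNReal.ofReal (l ^ (s - 1)) := by
        rw [lintegral_lintegral_swap]
        apply Measurable.aemeasurable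
        refine Measurable.mul (Measurable.ite (measurableSet_lt (by fun_prop) (hM.comp measurable_fst)) measurable_const measurable_const) (by fun_prop)
    _ = ENNReal.ofReal s * ∫⁻ l in Ioi (0 : ℝ), volume {x : En n | ENNReal.ofReal l < MM n g x} * ENNReal.ofReal (l ^ (s - 1)) := by
        congr 2; ext l
        rw [lintegral_mul_const' _ _ ENNReal.ofReal_ne_top]
        congr 1
        have : (fun x => if ENNReal.ofReal l < MM n g x then (1 : ℝ≥0∞) else 0) = {x : En n | ENNReal.ofReal l < MM n g x}.indicator 1 := by
          ext x; simp [indicator]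
        rw [this, lintegral_indicator_one (measurableSet_lt measurable_const hM)]
    _ ≤ ENNReal.ofReal s * ∫⁻ l in Ioi (0 : ℝ), ENNReal.ofReal (5 ^ n) * 2 * ∫⁻ y, g y * ((if ENNReal.ofReal l < 2 * g y then 1 else 0) * ENNReal.ofReal (l ^ (s - 1 - 1))) := by
        gcongr ENNReal.ofReal s * ?_
        exact setLIntegral_mono' measurableSet_Ioi fun l hl => hw l hl
    _ = ENNReal.ofReal s * (ENNReal.ofReal (5 ^ n) * 2 * ∫⁻ y, ∫⁻ l in Ioi (0 : ℝ), g y * ((if ENNReal.ofReal l < 2 * g y then 1 else 0) * ENNReal.ofReal (l ^ (s - 1 - 1)))) := by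
        rw [lintegral_const_mul' _ _ (by finiteness), lintegral_lintegral_swap]
        apply Measurable.aemeasurable
        refine (hg.comp measurable_snd).mul (Measurable.mul (Measurable.ite (measurableSet_lt (by fun_prop) ((hg.comp measurable_snd).const_mul 2)) measurable_const measurable_const) (by fun_prop))
    _ = ENNReal.ofReal s * (ENNReal.ofReal (5 ^ n) * 2 * ∫⁻ y, (2 ^ (s-1) * (ENNReal.ofReal (s - 1))⁻¹) * g y ^ s) := by
        congr 3; ext y
        have hms : Measurable fun l : ℝ => (if ENNReal.ofReal l < 2 * g y then (1 : ℝ≥0∞) else 0) * ENNReal.ofReal (l ^ (s - 1 - 1)) :=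
          Measurable.mul (Measurable.ite (measurableSet_lt (by fun_prop) measurable_const) measurable_const measurable_const) (by fun_prop)
        rw [lintegral_const_mul _ hms]
        have h := layer_aux (2 * g y) hs1
        have h0 : ENNReal.ofReal (s - 1) ≠ 0 := by simpa using hs
        have h' : (∫⁻ l in Ioi (0 : ℝ), (if ENNReal.ofReal l < 2 * g y then (1 : ℝ≥0∞) else 0) * ENNReal.ofReal (l ^ (s - 1 - 1))) = (ENNReal.ofReal (s - 1))⁻¹ * (2 * g y) ^ (s - 1) := by
          rw [h, ← mul_assoc, ENNReal.inv_mul_cancel h0 ENNReal.ofReal_ne_top, one_mul]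
        rw [h', ENNReal.mul_rpow_of_nonneg _ _ hs1.le]
        have h4 : g y ^ s = g y * g y ^ (s - 1) := by
          conv_lhs => rw [show s = 1 + (s - 1) by ring]
          rw [ENNReal.rpow_add_of_nonneg _ _ zero_le_one hs1.le, ENNReal.rpow_one]
        rw [h4]; ring
    _ = _ := by
        rw [lintegral_const_mul _ (hg.pow_const s)]; ring

lemma add_rpow_le (a b : ℝ≥0∞) {s : ℝ} (hs : 0 ≤ s) : (a + b) ^ s ≤ 2 ^ s * (a ^ s + b ^ s) := by
  have h1 : a + b ≤ 2 * max a b := by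
    rw [two_mul]; exact add_le_add (le_max_left _ _) (le_max_right _ _)
  calc (a + b) ^ s ≤ (2 * max a b) ^ s := ENNReal.rpow_le_rpow h1 hs
    _ = 2 ^ s * (max a b) ^ s := ENNReal.mul_rpow_of_nonneg _ _ hs
    _ ≤ _ := by
        gcongr
        rcases le_total a b with h | h
        · rw [max_eq_right h]; exact le_add_self
        · rw [max_eq_left h]; exact le_self_add

lemma sum_rpow_le {ι : Type*} [Fintype ι] (a : ι → ℝ≥0∞) {s : ℝ} (hs : 0 < s) :
    (∑ i, a i) ^ s ≤ (Fintype.card ι : ℝ≥0∞) ^ s * ∑ i, a i ^ s := by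
  set B := (∑ i, a i ^ s) ^ (1 / s) with hB
  have h1 : ∀ i, a i ≤ B := by
    intro i
    calc a i = (a i ^ s) ^ (1 / s) := by
          rw [← ENNReal.rpow_mul, mul_one_div_cancel hs.ne', ENNReal.rpow_one]
      _ ≤ _ := by
          apply ENNReal.rpow_le_rpow _ (by positivity)
          exact Finset.single_le_sum (f := fun i => a i ^ s) (fun _ _ => zero_le) (Finset.mem_univ i)
  have h2 : ∑ i, a i ≤ (Fintype.card ι : ℝ≥0∞) * B := by
    have := Finset.sum_le_card_nsmul Finset.univ a B (fun i _ => h1 i)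
    simpa using this
  calc _ ≤ ((Fintype.card ι : ℝ≥0∞) * B) ^ s := ENNReal.rpow_le_rpow h2 hs.le
    _ = _ := by
      rw [ENNReal.mul_rpow_of_nonneg _ _ hs.le, hB, ← ENNReal.rpow_mul, one_div_mul_cancel hs.ne', ENNReal.rpow_one]

lemma holder_set (n : ℕ) {s : ℝ} (hs : 1 < s) (S : Set (En n)) (g : En n → ℝ≥0∞) (hg : Measurable g) :
    ∫⁻ y in S, g y ≤ volume S ^ (1 - 1 / s) * (∫⁻ y in S, g y ^ s) ^ (1 / s) := by
  have hc := Real.HolderConjugate.conjExponent hs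
  have h := ENNReal.lintegral_mul_le_Lp_mul_Lq (volume.restrict S) hc hg.aemeasurable
    (aemeasurable_const (b := (1 : ℝ≥0∞)))
  have h2 : 1 / s.conjExponent = 1 - 1 / s := by
    have := hc.inv_add_inv_eq_one
    simp only [one_div]; linarith
  simp only [Pi.mul_apply, mul_one, ENNReal.one_rpow, lintegral_const, one_mul,
    Measure.restrict_apply_univ, h2] at h
  rwa [mul_comm]

/-- local average at scale `t` -/
def AA (n : ℕ) (t : ℝ) (g : En n → ℝ≥0∞) (z : En n) : ℝ≥0∞ :=
  (volume (ball (0 : En n) t))⁻¹ * ∫⁻ w in ball z t, g w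

lemma meas_AA (n : ℕ) (t : ℝ) (g : En n → ℝ≥0∞) (hg : Measurable g) : Measurable (AA n t g) :=
  (meas_ballInt n t g hg).const_mul _

lemma vol_center (n : ℕ) (x : En n) (t : ℝ) : volume (ball x t) = volume (ball (0 : En n) t) :=
  Measure.addHaar_ball_center _ _ _

lemma avg_le (n : ℕ) {t : ℝ} (ht : 0 < t) (g : En n → ℝ≥0∞) (hg : Measurable g) (S S' : Set (En n))
    (hS : MeasurableSet S) (h : ∀ w ∈ S, ball w t ⊆ S') :
    ∫⁻ y in S, g y ≤ ∫⁻ z in S', AA n t g z := by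
  have hv0 := vol_ball_ne_zero n 0 ht
  have hvt := vol_ball_ne_top n 0 t
  set D := {z : En n × En n | dist z.2 z.1 < t} with hD
  have e1 : ∀ z : En n, ∫⁻ w in ball z t, g w = ∫⁻ w, D.indicator (fun u => g u.2) (z, w) := by
    intro z
    rw [← lintegral_indicator measurableSet_ball]
    rfl
  have hm : Measurable (D.indicator (fun u : En n × En n => g u.2)) :=
    (hg.comp measurable_snd).indicator (meas_ball_set n t)
  have e2 : ∫⁻ z in S', ∫⁻ w in ball z t, g w = ∫⁻ w, ∫⁻ z in S', D.indicator (fun u => g u.2) (z, w) := by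
    simp_rw [e1]
    exact lintegral_lintegral_swap hm.aemeasurable
  have e3 : ∀ w ∈ S, ∫⁻ z in S', D.indicator (fun u => g u.2) (z, w) = volume (ball (0 : En n) t) * g w := by
    intro w hw
    have : (fun z => D.indicator (fun u : En n × En n => g u.2) (z, w)) = (ball w t).indicator fun _ => g w := by
      ext z
      by_cases hz : dist w z < t
      · rw [indicator_of_mem (show (z, w) ∈ D from hz), indicator_of_mem (by rwa [mem_ball, dist_comm])]
      · rw [indicator_of_notMem (show (z, w) ∉ D from hz), indicator_of_notMem (by rwa [mem_ball, dist_comm])]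
    rw [this, lintegral_indicator measurableSet_ball, Measure.restrict_restrict measurableSet_ball,
      inter_eq_left.2 (h w hw), lintegral_const, Measure.restrict_apply_univ, vol_center, mul_comm]
  unfold AA
  rw [lintegral_const_mul _ (meas_ballInt n t g hg), e2]
  calc ∫⁻ y in S, g y = (volume (ball (0 : En n) t))⁻¹ * ∫⁻ y in S, volume (ball (0 : En n) t) * g y := by
        rw [lintegral_const_mul _ hg, ← mul_assoc, ENNReal.inv_mul_cancel hv0 hvt, one_mul]
    _ = (volume (ball (0 : En n) t))⁻¹ * ∫⁻ w in S, ∫⁻ z in S', D.indicator (fun u => g u.2) (z, w) := by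
        congr 1
        exact setLIntegral_congr_fun hS fun w hw => (e3 w hw).symm
    _ ≤ _ := by gcongr; exact Measure.restrict_le_self

/-- the `q`-th power of the (unnormalised) slice norm -/
def PP (n : ℕ) (t r q : ℝ) (g : En n → ℝ≥0∞) : ℝ≥0∞ :=
  ∫⁻ x, (∫⁻ y in ball x t, g y ^ r) ^ (q / r)

lemma PP_mono (n : ℕ) (t : ℝ) {r q : ℝ} (hr : 1 < r) (hq : 1 < q) (g h : En n → ℝ≥0∞)
    (hgh : g ≤ᵐ[volume] h) : PP n t r q g ≤ PP n t r q h := by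
  unfold PP
  refine lintegral_mono fun x => ?_
  refine ENNReal.rpow_le_rpow ?_ (by positivity)
  refine lintegral_mono_ae ?_
  filter_upwards [ae_restrict_of_ae hgh] with y hy
  exact ENNReal.rpow_le_rpow hy (by positivity)

lemma PP_add (n : ℕ) (t : ℝ) {r q : ℝ} (hr : 1 < r) (hq : 1 < q) (g h : En n → ℝ≥0∞)
    (hg : Measurable g) :
    PP n t r q (fun x => g x + h x) ≤ 2 ^ q * 2 ^ (q / r) * (PP n t r q g + PP n t r q h) := by
  have hr0 : 0 < r := by linarith
  have hqr : 0 ≤ q / r := by positivity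
  unfold PP
  have hm := (meas_ballInt n t _ (hg.pow_const r)).pow_const (q / r)
  rw [← lintegral_add_left hm, ← lintegral_const_mul' _ _ (by finiteness)]
  refine lintegral_mono fun x => ?_
  calc (∫⁻ y in ball x t, (g y + h y) ^ r) ^ (q / r)
      ≤ (∫⁻ y in ball x t, 2 ^ r * (g y ^ r + h y ^ r)) ^ (q / r) := by
        gcongr with y
        exact add_rpow_le _ _ (by positivity)
    _ = (2 ^ r * ((∫⁻ y in ball x t, g y ^ r) + ∫⁻ y in ball x t, h y ^ r)) ^ (q / r) := by
        rw [lintegral_const_mul' _ _ (by finiteness), lintegral_add_left (hg.pow_const r)]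
    _ = 2 ^ q * ((∫⁻ y in ball x t, g y ^ r) + ∫⁻ y in ball x t, h y ^ r) ^ (q / r) := by
        rw [ENNReal.mul_rpow_of_nonneg _ _ hqr, ← ENNReal.rpow_mul, mul_div_cancel₀ _ hr0.ne']
    _ ≤ _ := by
        rw [mul_assoc]
        gcongr
        exact add_rpow_le _ _ hqr

lemma AA_le (n : ℕ) {t r q : ℝ} (ht : 0 < t) (hr : 1 < r) (hq : 1 < q) :
    ∃ C : ℝ≥0∞, C ≠ ∞ ∧ ∀ g : En n → ℝ≥0∞, Measurable g →
      ∫⁻ x, AA n t g x ^ q ≤ C * PP n t r q g := by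
  have hr0 : 0 < r := by linarith
  have hv0 := vol_ball_ne_zero n 0 ht
  have hvt := vol_ball_ne_top n 0 t
  have hr1 : 0 ≤ 1 - 1 / r := by
    rw [sub_nonneg, div_le_one hr0]; exact hr.le
  set c := (volume (ball (0 : En n) t))⁻¹ * (volume (ball (0 : En n) t)) ^ (1 - 1 / r) with hc
  have hct : c ≠ ∞ := ENNReal.mul_ne_top (ENNReal.inv_ne_top.2 hv0) (ENNReal.rpow_ne_top_of_nonneg hr1 hvt)
  have hcq : c ^ q ≠ ∞ := ENNReal.rpow_ne_top_of_nonneg (by linarith) hct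
  refine ⟨c ^ q, hcq, fun g hg => ?_⟩
  unfold PP
  rw [← lintegral_const_mul' _ _ hcq]
  refine lintegral_mono fun x => ?_
  calc AA n t g x ^ q ≤ (c * (∫⁻ y in ball x t, g y ^ r) ^ (1 / r)) ^ q := by
        gcongr
        unfold AA
        rw [hc, mul_assoc]
        gcongr
        have := holder_set n hr (ball x t) g hg
        rwa [vol_center] at this
    _ = _ := by
        rw [ENNReal.mul_rpow_of_nonneg _ _ (by linarith), ← ENNReal.rpow_mul, one_div_mul_eq_div]

lemma PP_translate (n : ℕ) (t r q : ℝ) (g : En n → ℝ≥0∞) (z : En n) :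
    ∫⁻ x, (∫⁻ y in ball (x + z) t, g y ^ r) ^ (q / r) = PP n t r q g :=
  lintegral_add_right_eq_self (fun x => (∫⁻ y in ball x t, g y ^ r) ^ (q / r)) z

lemma ball_cover_le (n : ℕ) {t : ℝ} (F : Finset (En n))
    (hcov : closedBall (0 : En n) (2 * t) ⊆ ⋃ z ∈ F, ball z t) (g : En n → ℝ≥0∞) (x : En n) :
    ∫⁻ y in ball x (2 * t), g y ≤ ∑ z : F, ∫⁻ y in ball (x + z) t, g y := by
  have hsub : ball x (2 * t) ⊆ ⋃ z : F, ball (x + z) t := by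
    intro y hy
    have : y - x ∈ closedBall (0 : En n) (2 * t) := by
      rw [mem_closedBall, dist_zero_right, ← dist_eq_norm]; exact (mem_ball.1 hy).le
    obtain ⟨z, hz, hyz⟩ := mem_iUnion₂.1 (hcov this)
    refine mem_iUnion.2 ⟨⟨z, hz⟩, ?_⟩
    rw [mem_ball, dist_eq_norm] at hyz ⊢
    rwa [← sub_sub]
  calc _ ≤ ∫⁻ y in ⋃ z : F, ball (x + z) t, g y := lintegral_mono_set hsub
    _ ≤ ∑' z : F, ∫⁻ y in ball (x + z) t, g y := lintegral_iUnion_le _ _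
    _ = _ := tsum_fintype _

lemma ball_cover_exists (n : ℕ) {t : ℝ} (ht : 0 < t) : ∃ F : Finset (En n),
    closedBall (0 : En n) (2 * t) ⊆ ⋃ z ∈ F, ball z t := by
  obtain ⟨F', -, hF, hcov⟩ := (isCompact_closedBall (0 : En n) (2 * t)).finite_cover_balls ht
  exact ⟨hF.toFinset, by simpa using hcov⟩

lemma PP_double_aux (n : ℕ) {t r q : ℝ} (hqr : 0 < q / r) (F : Finset (En n))
    (hcov : closedBall (0 : En n) (2 * t) ⊆ ⋃ z ∈ F, ball z t) (g : En n → ℝ≥0∞) :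
    PP n (2 * t) r q g ≤ ∫⁻ x, (Fintype.card F : ℝ≥0∞) ^ (q / r) *
      ∑ z : F, (∫⁻ y in ball (x + (z : En n)) t, g y ^ r) ^ (q / r) := by
  refine lintegral_mono fun x => ?_
  refine le_trans ?_ (sum_rpow_le _ hqr)
  refine ENNReal.rpow_le_rpow ?_ hqr.le
  exact ball_cover_le n F hcov _ x

lemma PP_double_aux2 (n : ℕ) {t r q : ℝ} (F : Finset (En n)) (g : En n → ℝ≥0∞) (hg : Measurable g) :
    ∫⁻ x, ∑ z : F, (∫⁻ y in ball (x + (z : En n)) t, g y ^ r) ^ (q / r) =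
      Fintype.card F * PP n t r q g := by
  have hm := (meas_ballInt n t _ (hg.pow_const r)).pow_const (q / r)
  rw [lintegral_finsetSum]
  · simp_rw [PP_translate]
    rw [Finset.sum_const, nsmul_eq_mul, Finset.card_univ]
  · intro z _
    exact hm.comp (measurable_add_const (z : En n))

lemma PP_double (n : ℕ) {t r q : ℝ} (ht : 0 < t) (hr : 1 < r) (hq : 1 < q) :
    ∃ C : ℝ≥0∞, C ≠ ∞ ∧ ∀ g : En n → ℝ≥0∞, Measurable g →
      PP n (2 * t) r q g ≤ C * PP n t r q g := by
  have hr0 : 0 < r := by linarith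
  have hqr : 0 < q / r := by positivity
  obtain ⟨F, hcov⟩ := ball_cover_exists n ht
  have hcard : (Fintype.card F : ℝ≥0∞) ^ (q / r) ≠ ∞ := ENNReal.rpow_ne_top_of_nonneg hqr.le (ENNReal.natCast_ne_top _)
  refine ⟨(Fintype.card F : ℝ≥0∞) ^ (q / r) * Fintype.card F, ENNReal.mul_ne_top hcard (ENNReal.natCast_ne_top _), fun g hg => ?_⟩
  refine (PP_double_aux n hqr F hcov g).trans ?_
  rw [lintegral_const_mul' _ _ hcard, PP_double_aux2 n F g hg, mul_assoc]

lemma MM_local (n : ℕ) {t : ℝ} (ht : 0 < t) (g : En n → ℝ≥0∞) (hg : Measurable g) (x y : En n)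
    (hy : y ∈ ball x t) :
    MM n g y ≤ MM n ((ball x (2 * t)).indicator g) y + ENNReal.ofReal (3 ^ n) * MM n (AA n t g) x := by
  apply MM_le
  intro ρ hρ
  rw [mul_add]
  have hy' : dist y x < t := hy
  rcases le_or_gt ρ t with h | h
  · refine le_trans ?_ le_self_add
    refine le_trans (le_of_eq ?_) (le_MM n _ y hρ)
    refine setLIntegral_congr_fun measurableSet_ball fun w hw => ?_
    have hw' : dist w y < ρ := hw
    have : w ∈ ball x (2 * t) := by
      rw [mem_ball]; linarith [dist_triangle w y x]
    simp only [indicator_of_mem this]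
  · refine le_trans ?_ le_add_self
    have hρ2 : 0 < ρ + 2 * t := by linarith
    calc ∫⁻ w in ball y ρ, g w ≤ ∫⁻ z in ball x (ρ + 2 * t), AA n t g z := by
          apply avg_le n ht g hg _ _ measurableSet_ball
          intro w hw z hz
          rw [mem_ball] at *
          linarith [dist_triangle w y x, dist_triangle z w x]
      _ ≤ volume (ball x (ρ + 2 * t)) * MM n (AA n t g) x := le_MM n _ x hρ2
      _ ≤ (volume (ball y ρ) * ENNReal.ofReal (3 ^ n)) * MM n (AA n t g) x := by
          gcongr
          rw [vol_ball n x hρ2, vol_ball n y hρ]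
          rw [mul_right_comm, ← ENNReal.ofReal_mul (by positivity), ← mul_pow]
          gcongr
          linarith
      _ = _ := by ring

lemma PP_MM (n : ℕ) {t r q : ℝ} (ht : 0 < t) (hr : 1 < r) (hq : 1 < q) :
    ∃ C : ℝ≥0∞, C ≠ ∞ ∧ ∀ g : En n → ℝ≥0∞, Measurable g →
      PP n t r q (MM n g) ≤ C * PP n t r q g := by
  have hr0 : 0 < r := by linarith
  have hq0 : 0 < q := by linarith
  have hqr : 0 < q / r := by positivity
  obtain ⟨C1, hC1, h1⟩ := HL_strong n hr
  obtain ⟨C2, hC2, h2⟩ := HL_strong n hq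
  obtain ⟨C3, hC3, h3⟩ := PP_double n ht hr hq
  obtain ⟨C4, hC4, h4⟩ := AA_le n ht hr hq
  have hvt := vol_ball_ne_top n 0 t
  set v := volume (ball (0 : En n) t) with hv
  set K : ℝ≥0∞ := 2 ^ r * C1 with hK
  set L : ℝ≥0∞ := 2 ^ r * (v * ENNReal.ofReal (3 ^ n) ^ r) with hL
  have hKt : K ≠ ∞ := by finiteness
  have hLt : L ≠ ∞ := by finiteness
  refine ⟨2 ^ (q / r) * (K ^ (q / r) * C3 + L ^ (q / r) * (C2 * C4)), by finiteness, fun g hg => ?_⟩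
  have hpt : ∀ x : En n, ∫⁻ y in ball x t, MM n g y ^ r ≤
      K * (∫⁻ y in ball x (2 * t), g y ^ r) + L * MM n (AA n t g) x ^ r := by
    intro x
    have hmi : Measurable ((ball x (2 * t)).indicator g) := hg.indicator measurableSet_ball
    calc ∫⁻ y in ball x t, MM n g y ^ r
        ≤ ∫⁻ y in ball x t, 2 ^ r * (MM n ((ball x (2 * t)).indicator g) y ^ r +
            (ENNReal.ofReal (3 ^ n) * MM n (AA n t g) x) ^ r) := by
          refine setLIntegral_mono' measurableSet_ball fun y hy => ?_
          refine le_trans ?_ (add_rpow_le _ _ hr0.le)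
          gcongr
          exact MM_local n ht g hg x y hy
      _ = 2 ^ r * ((∫⁻ y in ball x t, MM n ((ball x (2 * t)).indicator g) y ^ r) +
            (ENNReal.ofReal (3 ^ n) * MM n (AA n t g) x) ^ r * v) := by
          rw [lintegral_const_mul' _ _ (by finiteness), lintegral_add_right _ measurable_const,
            lintegral_const, Measure.restrict_apply_univ, vol_center]
      _ ≤ 2 ^ r * (C1 * (∫⁻ y in ball x (2 * t), g y ^ r) +
            (ENNReal.ofReal (3 ^ n) * MM n (AA n t g) x) ^ r * v) := by
          gcongr
          calc _ ≤ ∫⁻ y, MM n ((ball x (2 * t)).indicator g) y ^ r := by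
                exact setLIntegral_le_lintegral _ _
            _ ≤ C1 * ∫⁻ y, ((ball x (2 * t)).indicator g) y ^ r := h1 _ hmi
            _ = _ := by
                rw [← lintegral_indicator measurableSet_ball]
                congr 2; ext y
                by_cases hy : y ∈ ball x (2 * t)
                · simp only [indicator_of_mem hy]
                · simp only [indicator_of_notMem hy, ENNReal.zero_rpow_of_pos hr0]
      _ = _ := by
          rw [ENNReal.mul_rpow_of_nonneg _ _ hr0.le, hK, hL]; ring
  have hmA := meas_MM n _ (meas_AA n t g hg)
  calc PP n t r q (MM n g)
      ≤ ∫⁻ x, 2 ^ (q / r) * (K ^ (q / r) * (∫⁻ y in ball x (2 * t), g y ^ r) ^ (q / r) + L ^ (q / r) * MM n (AA n t g) x ^ q) := by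
        refine lintegral_mono fun x => ?_
        refine (ENNReal.rpow_le_rpow (hpt x) hqr.le).trans ?_
        refine (add_rpow_le _ _ hqr.le).trans (le_of_eq ?_)
        rw [ENNReal.mul_rpow_of_nonneg K _ hqr.le, ENNReal.mul_rpow_of_nonneg L _ hqr.le,
          ← ENNReal.rpow_mul (MM n (AA n t g) x), mul_div_cancel₀ _ hr0.ne']
    _ = 2 ^ (q / r) * (K ^ (q / r) * PP n (2 * t) r q g + L ^ (q / r) * ∫⁻ x, MM n (AA n t g) x ^ q) := by
        rw [lintegral_const_mul' _ _ (by finiteness), lintegral_add_right _ ((hmA.pow_const q).const_mul _),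
          lintegral_const_mul' _ _ (by finiteness), lintegral_const_mul' _ _ (by finiteness)]
        rfl
    _ ≤ 2 ^ (q / r) * (K ^ (q / r) * (C3 * PP n t r q g) + L ^ (q / r) * (C2 * (C4 * PP n t r q g))) := by
        gcongr
        · exact h3 g hg
        · refine (h2 _ (meas_AA n t g hg)).trans ?_
          gcongr
          exact h4 g hg
    _ = _ := by ring

lemma PP_const (n : ℕ) {t r q : ℝ} (ht : 0 < t) (hr : 1 < r) (hq : 1 < q) :
    ∃ C : ℝ≥0∞, C ≠ ∞ ∧ ∀ (c : ℝ≥0∞) (R : ℝ), 1 ≤ R →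
      PP n t r q ((closedBall (0 : En n) R).indicator fun _ => c) ≤ C * c ^ q * ENNReal.ofReal (R ^ n) := by
  have hr0 : 0 < r := by linarith
  have hq0 : 0 < q := by linarith
  have hqr : 0 < q / r := by positivity
  have hvt := vol_ball_ne_top n 0 t
  have hvt1 := vol_ball_ne_top n 0 1
  set v := volume (ball (0 : En n) t) with hv
  refine ⟨v ^ (q / r) * (ENNReal.ofReal ((1 + t) ^ n) * volume (ball (0 : En n) 1)), by finiteness, fun c R hR => ?_⟩
  unfold PP
  calc _ ≤ ∫⁻ x, (closedBall (0 : En n) (R + t)).indicator (fun _ => c ^ q * v ^ (q / r)) x := by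
        refine lintegral_mono fun x => ?_
        by_cases hx : x ∈ closedBall (0 : En n) (R + t)
        · rw [indicator_of_mem hx]
          calc _ ≤ (∫⁻ y in ball x t, c ^ r) ^ (q / r) := by
                gcongr with y
                exact indicator_le_self' (fun _ _ => zero_le) y
            _ = _ := by
                rw [lintegral_const, Measure.restrict_apply_univ, vol_center, ENNReal.mul_rpow_of_nonneg _ _ hqr.le,
                  ← ENNReal.rpow_mul, mul_div_cancel₀ _ hr0.ne']
        · rw [indicator_of_notMem hx]
          have : ∫⁻ y in ball x t, ((closedBall (0 : En n) R).indicator (fun _ => c) y) ^ r = ∫⁻ y in ball x t, 0 := by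
            refine setLIntegral_congr_fun measurableSet_ball fun y hy => ?_
            have : y ∉ closedBall (0 : En n) R := by
              intro h
              apply hx
              rw [mem_closedBall] at *
              rw [mem_ball] at hy
              linarith [dist_triangle x y 0, dist_comm x y]
            simp only [indicator_of_notMem this, ENNReal.zero_rpow_of_pos hr0]
          rw [this]
          simp [hqr]
    _ = c ^ q * v ^ (q / r) * (ENNReal.ofReal ((R + t) ^ n) * volume (ball (0 : En n) 1)) := by
        rw [lintegral_indicator measurableSet_closedBall, lintegral_const, Measure.restrict_apply_univ,
          vol_closedBall n _ (by linarith)]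
    _ ≤ c ^ q * v ^ (q / r) * (ENNReal.ofReal ((1 + t) ^ n * R ^ n) * volume (ball (0 : En n) 1)) := by
        gcongr
        rw [← mul_pow]
        gcongr
        nlinarith
    _ = _ := by
        rw [ENNReal.ofReal_mul (by positivity)]; ring

lemma PP_int (n : ℕ) {t r q : ℝ} (ht : 0 < t) (hr : 1 < r) (hq : 1 < q) :
    ∃ C : ℝ≥0∞, C ≠ ∞ ∧ ∀ (g : En n → ℝ≥0∞), Measurable g → ∀ (R : ℝ), 1 ≤ R →
      ∫⁻ y in closedBall (0 : En n) R, g y ≤ C * ENNReal.ofReal (R ^ n) ^ (1 - 1 / q) * PP n t r q g ^ (1 / q) := by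
  have hq0 : 0 < q := by linarith
  have hvt1 := vol_ball_ne_top n 0 1
  obtain ⟨C4, hC4, h4⟩ := AA_le n ht hr hq
  have hq1 : 0 ≤ 1 - 1 / q := by
    rw [sub_nonneg, div_le_one hq0]; exact hq.le
  have hq2 : 0 ≤ 1 / q := by positivity
  refine ⟨(ENNReal.ofReal ((1 + t) ^ n) * volume (ball (0 : En n) 1)) ^ (1 - 1 / q) * C4 ^ (1 / q), by finiteness, fun g hg R hR => ?_⟩
  calc ∫⁻ y in closedBall (0 : En n) R, g y ≤ ∫⁻ z in closedBall (0 : En n) (R + t), AA n t g z := by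
        apply avg_le n ht g hg _ _ measurableSet_closedBall
        intro w hw z hz
        rw [mem_closedBall] at *
        rw [mem_ball] at hz
        linarith [dist_triangle z w 0]
    _ ≤ volume (closedBall (0 : En n) (R + t)) ^ (1 - 1 / q) * (∫⁻ y in closedBall (0 : En n) (R + t), AA n t g y ^ q) ^ (1 / q) :=
        holder_set n hq _ _ (meas_AA n t g hg)
    _ ≤ ((ENNReal.ofReal ((1 + t) ^ n) * volume (ball (0 : En n) 1)) * ENNReal.ofReal (R ^ n)) ^ (1 - 1 / q) * (C4 * PP n t r q g) ^ (1 / q) := by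
        gcongr
        · rw [vol_closedBall n _ (by linarith), mul_right_comm, ← ENNReal.ofReal_mul (by positivity), ← mul_pow]
          gcongr
          nlinarith
        · exact (setLIntegral_le_lintegral _ _).trans (h4 g hg)
    _ = _ := by
        rw [ENNReal.mul_rpow_of_nonneg _ _ hq1, ENNReal.mul_rpow_of_nonneg _ _ hq2]; ring

lemma sliceNorm_eq (n : ℕ) {t r : ℝ} (hr : 1 < r) (q : ℝ≥0∞) (hq : 1 < q) (hq' : q ≠ ∞)
    (ht : 0 < t) (g : En n → ℝ≥0∞) :
    sliceNorm n t r q g =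
      ((volume (ball (0 : En n) t))⁻¹) ^ (1 / r) * PP n t r q.toReal g ^ (1 / q.toReal) := by
  have hq1 : 1 < q.toReal := by
    rw [← ENNReal.toReal_one]; exact (ENNReal.toReal_lt_toReal (by simp) hq').2 hq
  have hq0 : 0 < q.toReal := by linarith
  have hr0 : 0 < r := by linarith
  have hv0 := vol_ball_ne_zero n 0 ht
  set v := volume (ball (0 : En n) t) with hv
  have hvi : v⁻¹ ≠ ∞ := ENNReal.inv_ne_top.2 hv0
  unfold sliceNorm PP
  rw [if_neg hq']
  have e : ∀ x : En n, (((volume (ball x t))⁻¹ * ∫⁻ y in ball x t, g y ^ r) ^ (1 / r)) ^ q.toReal =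
      (v⁻¹) ^ (q.toReal / r) * (∫⁻ y in ball x t, g y ^ r) ^ (q.toReal / r) := by
    intro x
    rw [vol_center, ← ENNReal.rpow_mul, one_div_mul_eq_div, ENNReal.mul_rpow_of_nonneg _ _ (by positivity)]
  simp_rw [e]
  rw [lintegral_const_mul' _ _ (ENNReal.rpow_ne_top_of_nonneg (by positivity) hvi),
    ENNReal.mul_rpow_of_nonneg _ _ (by positivity), ← ENNReal.rpow_mul]
  congr 2
  field_simp

/-- All properties of the slice norm that are used in the Herz part. -/
structure SliceProps (n : ℕ) (q : ℝ) (N : (En n → ℝ≥0∞) → ℝ≥0∞) (C : ℝ≥0∞) : Prop where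
  ne_top : C ≠ ∞
  mono : ∀ g h : En n → ℝ≥0∞, g ≤ᵐ[volume] h → N g ≤ N h
  add : ∀ g h : En n → ℝ≥0∞, Measurable g → N (fun x => g x + h x) ≤ C * (N g + N h)
  max : ∀ g : En n → ℝ≥0∞, Measurable g → N (MM n g) ≤ C * N g
  const : ∀ (c : ℝ≥0∞) (R : ℝ), 1 ≤ R →
    N ((closedBall (0 : En n) R).indicator fun _ => c) ≤ C * c * ENNReal.ofReal (R ^ n) ^ (1 / q)
  int : ∀ (g : En n → ℝ≥0∞), Measurable g → ∀ (R : ℝ), 1 ≤ R →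
    ∫⁻ y in closedBall (0 : En n) R, g y ≤ C * ENNReal.ofReal (R ^ n) ^ (1 - 1 / q) * N g

lemma sliceProps (n : ℕ) {t r : ℝ} (ht : 0 < t) (hr : 1 < r) (q : ℝ≥0∞) (hq : 1 < q) (hq' : q ≠ ∞) :
    ∃ C, SliceProps n q.toReal (sliceNorm n t r q) C := by
  have hq1 : 1 < q.toReal := by
    rw [← ENNReal.toReal_one]; exact (ENNReal.toReal_lt_toReal (by simp) hq').2 hq
  have hr0 : 0 < r := by linarith
  have heq := sliceNorm_eq n hr q hq hq' ht
  generalize hQ : q.toReal = Q at *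
  have hq0 : 0 < Q := by linarith
  have hQi : 0 ≤ 1 / Q := by positivity
  have hv0 := vol_ball_ne_zero n 0 ht
  have hvt := vol_ball_ne_top n 0 t
  have hvi : (volume (ball (0 : En n) t))⁻¹ ≠ ∞ := ENNReal.inv_ne_top.2 hv0
  have hvi0 : (volume (ball (0 : En n) t))⁻¹ ≠ 0 := ENNReal.inv_ne_zero.2 hvt
  generalize hK : ((volume (ball (0 : En n) t))⁻¹) ^ (1 / r) = K at *
  have hKt : K ≠ ∞ := by rw [← hK]; exact ENNReal.rpow_ne_top_of_nonneg (by positivity) hvi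
  have hK0 : K ≠ 0 := by rw [← hK]; exact (ENNReal.rpow_pos (pos_iff_ne_zero.2 hvi0) hvi).ne'
  have hKi : K⁻¹ ≠ ∞ := ENNReal.inv_ne_top.2 hK0
  obtain ⟨C1, hC1, h1⟩ := PP_MM n ht hr hq1
  obtain ⟨C2, hC2, h2⟩ := PP_const n ht hr hq1
  obtain ⟨C3, hC3, h3⟩ := PP_int n ht hr hq1
  set C0 : ℝ≥0∞ := (2 ^ Q * 2 ^ (Q / r)) ^ (1 / Q) * 2 ^ (1 / Q) with hC0
  have hQr : 0 ≤ Q / r := by positivity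
  have hC0t : C0 ≠ ∞ := by finiteness
  refine ⟨C0 + C1 ^ (1 / Q) + K * C2 ^ (1 / Q) + C3 * K⁻¹, by finiteness, ?_, ?_, ?_, ?_, ?_⟩
  · intro g h hgh
    rw [heq, heq]
    gcongr
    exact PP_mono n t hr hq1 g h hgh
  · intro g h hg
    rw [heq, heq, heq]
    calc K * PP n t r Q (fun x => g x + h x) ^ (1 / Q)
        ≤ K * ((2 ^ Q * 2 ^ (Q / r)) * (PP n t r Q g + PP n t r Q h)) ^ (1 / Q) := by
          gcongr
          exact PP_add n t hr hq1 g h hg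
      _ ≤ K * ((2 ^ Q * 2 ^ (Q / r)) ^ (1 / Q) * (2 ^ (1 / Q) * (PP n t r Q g ^ (1 / Q) + PP n t r Q h ^ (1 / Q)))) := by
          rw [ENNReal.mul_rpow_of_nonneg _ _ hQi]
          gcongr
          exact add_rpow_le _ _ hQi
      _ = C0 * (K * PP n t r Q g ^ (1 / Q) + K * PP n t r Q h ^ (1 / Q)) := by rw [hC0]; ring
      _ ≤ _ := by
          gcongr
          rw [add_assoc, add_assoc]; exact le_self_add
  · intro g hg
    rw [heq, heq]
    calc K * PP n t r Q (MM n g) ^ (1 / Q) ≤ K * (C1 * PP n t r Q g) ^ (1 / Q) := by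
          gcongr; exact h1 g hg
      _ = C1 ^ (1 / Q) * (K * PP n t r Q g ^ (1 / Q)) := by
          rw [ENNReal.mul_rpow_of_nonneg _ _ hQi]; ring
      _ ≤ _ := by
          gcongr
          rw [add_assoc, add_assoc]; exact le_self_add.trans le_add_self
  · intro c R hR
    rw [heq]
    calc _ ≤ K * (C2 * c ^ Q * ENNReal.ofReal (R ^ n)) ^ (1 / Q) := by
          gcongr; exact h2 c R hR
      _ = (K * C2 ^ (1 / Q)) * c * ENNReal.ofReal (R ^ n) ^ (1 / Q) := by
          rw [ENNReal.mul_rpow_of_nonneg _ _ hQi, ENNReal.mul_rpow_of_nonneg _ _ hQi, ← ENNReal.rpow_mul c,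
            mul_one_div_cancel hq0.ne', ENNReal.rpow_one]
          ring
      _ ≤ _ := by
          gcongr
          exact le_add_self.trans le_self_add
  · intro g hg R hR
    rw [heq]
    calc _ ≤ _ := h3 g hg R hR
      _ = (C3 * K⁻¹) * ENNReal.ofReal (R ^ n) ^ (1 - 1 / Q) * (K * PP n t r Q g ^ (1 / Q)) := by
          calc _ = (K⁻¹ * K) * (C3 * ENNReal.ofReal (R ^ n) ^ (1 - 1 / Q) * PP n t r Q g ^ (1 / Q)) := by
                rw [ENNReal.inv_mul_cancel hK0 hKt, one_mul]
            _ = _ := by ring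
      _ ≤ _ := by
          gcongr
          exact le_add_self

lemma meas_piece (n k : ℕ) : MeasurableSet (pieceN n k) := by
  unfold pieceN
  split_ifs
  · exact measurableSet_closedBall
  · exact measurableSet_closedBall.diff measurableSet_closedBall

lemma piece_le (n k : ℕ) {x : En n} (hx : x ∈ pieceN n k) : ‖x‖ ≤ 2 ^ k := by
  unfold pieceN at hx
  split_ifs at hx with h
  · subst h
    simpa [ballZ] using hx
  · simpa [ballZ] using hx.1

lemma piece_gt (n k : ℕ) (hk : 1 ≤ k) {x : En n} (hx : x ∈ pieceN n k) : 2 ^ k / 2 < ‖x‖ := by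
  unfold pieceN at hx
  rw [if_neg (by omega)] at hx
  have h := hx.2
  simp only [ballZ, mem_closedBall, dist_zero_right, not_le] at h
  rw [zpow_sub₀ (by norm_num), zpow_one, zpow_natCast] at h
  exact h

lemma piece_cover (n : ℕ) (x : En n) : ∃ k, x ∈ pieceN n k := by
  classical
  have hex : ∃ k : ℕ, ‖x‖ ≤ 2 ^ k := by
    obtain ⟨k, hk⟩ := pow_unbounded_of_one_lt ‖x‖ (one_lt_two : (1 : ℝ) < 2)
    exact ⟨k, hk.le⟩
  refine ⟨Nat.find hex, ?_⟩
  have h1 := Nat.find_spec hex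
  have h2 := fun m => Nat.find_min hex (m := m)
  generalize Nat.find hex = k at *
  unfold pieceN
  split_ifs with h
  · subst h
    simpa [ballZ] using h1
  · refine ⟨by simpa [ballZ] using h1, ?_⟩
    have := h2 (k - 1) (by omega)
    have e : ((k : ℤ) - 1) = ((k - 1 : ℕ) : ℤ) := by omega
    simp only [ballZ, e, zpow_natCast, mem_closedBall, dist_zero_right]
    exact this

lemma piece_far (n k l : ℕ) (h : k + 2 ≤ l ∨ l + 2 ≤ k) {x y : En n} (hx : x ∈ pieceN n k)
    (hy : y ∈ pieceN n l) : 2 ^ (max k l) / 4 ≤ dist y x := by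
  have aux : ∀ a b : ℕ, a + 2 ≤ b → ∀ u w : En n, u ∈ pieceN n a → w ∈ pieceN n b →
      2 ^ b / 4 ≤ ‖w‖ - ‖u‖ := by
    intro a b hab u w hu hw
    have h1 := piece_le n a hu
    have h2 := piece_gt n b (by omega) hw
    have h3 : (2 : ℝ) ^ a * 4 ≤ 2 ^ b := by
      calc (2 : ℝ) ^ a * 4 = 2 ^ (a + 2) := by rw [pow_add]; norm_num
        _ ≤ 2 ^ b := pow_le_pow_right₀ (by norm_num) hab
    linarith
  rw [dist_eq_norm]
  rcases h with h | h
  · rw [max_eq_right (by omega)]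
    exact (aux k l h x y hx hy).trans (norm_sub_norm_le y x)
  · rw [max_eq_left (by omega), norm_sub_rev]
    exact (aux l k h y x hy hx).trans (norm_sub_norm_le x y)

lemma MM_far (n k l : ℕ) (h : k + 2 ≤ l ∨ l + 2 ≤ k) (g : En n → ℝ≥0∞) {x : En n}
    (hx : x ∈ pieceN n k) :
    MM n ((pieceN n l).indicator g) x ≤
      (volume (ball (0 : En n) (2 ^ (max k l) / 4)))⁻¹ * ∫⁻ y, (pieceN n l).indicator g y := by
  have hpos : (0 : ℝ) < 2 ^ (max k l) / 4 := by positivity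
  apply MM_le
  intro ρ hρ
  rcases le_or_gt ρ (2 ^ (max k l) / 4) with hle | hgt
  · have : ∫⁻ y in ball x ρ, (pieceN n l).indicator g y = ∫⁻ y in ball x ρ, 0 := by
      refine setLIntegral_congr_fun measurableSet_ball fun y hy => ?_
      have : y ∉ pieceN n l := by
        intro hyl
        have h1 := piece_far n k l h hx hyl
        rw [mem_ball] at hy
        linarith
      simp only [indicator_of_notMem this]
    rw [this]
    simp
  · calc ∫⁻ y in ball x ρ, (pieceN n l).indicator g y ≤ ∫⁻ y, (pieceN n l).indicator g y :=
          setLIntegral_le_lintegral _ _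
      _ = volume (ball (0 : En n) (2 ^ (max k l) / 4)) * ((volume (ball (0 : En n) (2 ^ (max k l) / 4)))⁻¹ * ∫⁻ y, (pieceN n l).indicator g y) := by
          rw [← mul_assoc, ENNReal.mul_inv_cancel (vol_ball_ne_zero n _ hpos) (vol_ball_ne_top n _ _), one_mul]
      _ ≤ _ := by
          rw [← vol_center n x]
          gcongr

lemma two_pow_rpow (n k : ℕ) (s : ℝ) :
    ENNReal.ofReal (((2 : ℝ) ^ k) ^ n) ^ s = (2 : ℝ≥0∞) ^ ((k : ℝ) * n * s) := by
  rw [ENNReal.ofReal_pow (by positivity), ENNReal.ofReal_pow (by norm_num), ENNReal.rpow_mul, ENNReal.rpow_mul,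
    ENNReal.rpow_natCast, ENNReal.rpow_natCast]
  simp

lemma vol_inv (n : ℕ) : ∃ D : ℝ≥0∞, D ≠ ∞ ∧ ∀ m : ℕ,
    (volume (ball (0 : En n) (2 ^ m / 4)))⁻¹ = D * (2 : ℝ≥0∞) ^ (-((m : ℝ) * n)) := by
  have h4 : ENNReal.ofReal (((1 : ℝ) / 4) ^ n) ≠ 0 := by
    rw [Ne, ENNReal.ofReal_eq_zero, not_le]; positivity
  have hV := vol_ball_ne_zero n 0 one_pos
  have hVt := vol_ball_ne_top n 0 1
  refine ⟨(ENNReal.ofReal ((1 / 4) ^ n) * volume (ball (0 : En n) 1))⁻¹, ?_, fun m => ?_⟩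
  · exact ENNReal.inv_ne_top.2 (mul_ne_zero h4 hV)
  · rw [vol_ball n 0 (by positivity), div_eq_mul_one_div ((2 : ℝ) ^ m) 4, mul_pow, ENNReal.ofReal_mul (by positivity)]
    have := two_pow_rpow n m 1
    rw [ENNReal.rpow_one, mul_one] at this
    rw [this, mul_assoc, ENNReal.mul_inv, ENNReal.rpow_neg, mul_comm]
    · right; finiteness
    · left; finiteness

lemma MM_le_tsum (n : ℕ) (g : En n → ℝ≥0∞) (hg : Measurable g) (x : En n) :
    MM n g x ≤ ∑' l : ℕ, MM n ((pieceN n l).indicator g) x := by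
  apply MM_le
  intro ρ hρ
  calc ∫⁻ y in ball x ρ, g y ≤ ∫⁻ y in ball x ρ, ∑' l : ℕ, (pieceN n l).indicator g y := by
        refine lintegral_mono fun y => ?_
        obtain ⟨l, hl⟩ := piece_cover n y
        refine le_trans ?_ (ENNReal.le_tsum l)
        rw [indicator_of_mem hl]
    _ = ∑' l : ℕ, ∫⁻ y in ball x ρ, (pieceN n l).indicator g y :=
        lintegral_tsum fun l => (hg.indicator (meas_piece n l)).aemeasurable
    _ ≤ ∑' l : ℕ, volume (ball x ρ) * MM n ((pieceN n l).indicator g) x :=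
        ENNReal.tsum_le_tsum fun l => le_MM n _ x hρ
    _ = _ := ENNReal.tsum_mul_left

lemma near_split (a c : ℕ → ℝ≥0∞) (k : ℕ)
    (h : ∀ l, k + 2 ≤ l ∨ l + 2 ≤ k → a l ≤ c l) :
    ∑' l, a l ≤ a (k - 1) + a k + a (k + 1) + ∑' l, c l := by
  calc ∑' l, a l ≤ ∑' l, ((if l = k - 1 then a (k - 1) else 0) + (if l = k then a k else 0) +
        (if l = k + 1 then a (k + 1) else 0) + c l) := by
        refine ENNReal.tsum_le_tsum fun l => ?_
        by_cases h1 : l = k - 1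
        · rw [if_pos h1, h1, add_assoc, add_assoc]; exact le_self_add
        by_cases h2 : l = k
        · rw [if_pos h2, ← h2, add_assoc, add_assoc]; exact le_self_add.trans le_add_self
        by_cases h3 : l = k + 1
        · rw [if_pos h3, ← h3, add_assoc]; exact le_self_add.trans le_add_self
        · exact (h l (by omega)).trans le_add_self
    _ = _ := by
        rw [ENNReal.tsum_add, ENNReal.tsum_add, ENNReal.tsum_add]
        simp only [tsum_ite_eq]

lemma weight_sum {δ : ℝ} (hδ : 0 < δ) : ∃ S : ℝ≥0∞, S ≠ ∞ ∧
    ∀ k : ℕ, ∑' l : ℕ, (2 : ℝ≥0∞) ^ (-(δ * |(k : ℝ) - l|)) ≤ S := by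
  set φ : ℤ → ℝ := fun m => (2 : ℝ) ^ (-(δ * |(m : ℝ)|)) with hφ
  have hx0 : (0 : ℝ) ≤ (2 : ℝ) ^ (-δ) := by positivity
  have hx1 : (2 : ℝ) ^ (-δ) < 1 := Real.rpow_lt_one_of_one_lt_of_neg (by norm_num) (by linarith)
  have hs : Summable φ := by
    have hg := summable_geometric_of_lt_one hx0 hx1
    have e : ∀ m : ℕ, (2 : ℝ) ^ (-(δ * (m : ℝ))) = ((2 : ℝ) ^ (-δ)) ^ m := by
      intro m
      rw [← Real.rpow_natCast, ← Real.rpow_mul (by norm_num)]; congr 1; ring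
    apply Summable.of_nat_of_neg
    · simpa [hφ, e] using hg
    · simpa [hφ, e] using hg
  refine ⟨∑' m : ℤ, ENNReal.ofReal (φ m), hs.tsum_ofReal_ne_top, fun k => ?_⟩
  have hinj : Function.Injective fun l : ℕ => ((k : ℤ) - l) := by
    intro a b hab
    simp only at hab
    omega
  refine le_trans (le_of_eq ?_) (ENNReal.tsum_comp_le_tsum_of_injective hinj (fun m => ENNReal.ofReal (φ m)))
  congr 1; ext l
  simp only [hφ]
  rw [← ENNReal.ofReal_rpow_of_pos (by norm_num)]
  simp

lemma seq_bound {δ p : ℝ} (hδ : 0 < δ) (hp : 0 < p) : ∃ S : ℝ≥0∞, S ≠ ∞ ∧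
    ∀ b : ℕ → ℝ≥0∞, (∑' k : ℕ, (∑' l : ℕ, (2 : ℝ≥0∞) ^ (-(δ * |(k : ℝ) - l|)) * b l) ^ p) ≤
      S * ∑' l, b l ^ p := by
  obtain ⟨S1, hS1, h1⟩ := weight_sum (half_pos hδ)
  obtain ⟨S2, hS2, h2⟩ := weight_sum (mul_pos (half_pos hδ) hp)
  have hS1p : S1 ^ p ≠ ∞ := ENNReal.rpow_ne_top_of_nonneg hp.le hS1
  refine ⟨S1 ^ p * S2, by finiteness, fun b => ?_⟩
  have key : ∀ k : ℕ, (∑' l : ℕ, (2 : ℝ≥0∞) ^ (-(δ * |(k : ℝ) - l|)) * b l) ^ p ≤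
      S1 ^ p * ∑' l : ℕ, (2 : ℝ≥0∞) ^ (-(δ / 2 * p * |(k : ℝ) - l|)) * b l ^ p := by
    intro k
    set B := ∑' l : ℕ, (2 : ℝ≥0∞) ^ (-(δ / 2 * p * |(k : ℝ) - l|)) * b l ^ p with hB
    have hl : ∀ l : ℕ, (2 : ℝ≥0∞) ^ (-(δ / 2 * |(k : ℝ) - l|)) * b l ≤ B ^ (1 / p) := by
      intro l
      calc _ = (((2 : ℝ≥0∞) ^ (-(δ / 2 * |(k : ℝ) - l|)) * b l) ^ p) ^ (1 / p) := by
            rw [← ENNReal.rpow_mul, mul_one_div_cancel hp.ne', ENNReal.rpow_one]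
        _ ≤ _ := by
            refine ENNReal.rpow_le_rpow ?_ (by positivity)
            rw [ENNReal.mul_rpow_of_nonneg _ _ hp.le, ← ENNReal.rpow_mul]
            refine le_trans (le_of_eq ?_) (ENNReal.le_tsum l)
            congr 2; ring
    calc _ ≤ (∑' l : ℕ, (2 : ℝ≥0∞) ^ (-(δ / 2 * |(k : ℝ) - l|)) * B ^ (1 / p)) ^ p := by
          refine ENNReal.rpow_le_rpow (ENNReal.tsum_le_tsum fun l => ?_) hp.le
          rw [show -(δ * |(k : ℝ) - l|) = -(δ / 2 * |(k : ℝ) - l|) + -(δ / 2 * |(k : ℝ) - l|) by ring,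
            ENNReal.rpow_add _ _ (by simp) (by simp), mul_assoc]
          gcongr
          exact hl l
      _ ≤ (S1 * B ^ (1 / p)) ^ p := by
          rw [ENNReal.tsum_mul_right]
          gcongr
          exact h1 k
      _ = _ := by
          rw [ENNReal.mul_rpow_of_nonneg _ _ hp.le, ← ENNReal.rpow_mul B, one_div_mul_cancel hp.ne', ENNReal.rpow_one]
  calc _ ≤ ∑' k : ℕ, S1 ^ p * ∑' l : ℕ, (2 : ℝ≥0∞) ^ (-(δ / 2 * p * |(k : ℝ) - l|)) * b l ^ p :=
        ENNReal.tsum_le_tsum key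
    _ = S1 ^ p * ∑' l : ℕ, (∑' k : ℕ, (2 : ℝ≥0∞) ^ (-(δ / 2 * p * |(l : ℝ) - k|))) * b l ^ p := by
        rw [ENNReal.tsum_mul_left, ENNReal.tsum_comm]
        congr 2; ext l
        rw [← ENNReal.tsum_mul_right]
        congr 1; ext k
        rw [abs_sub_comm]
    _ ≤ S1 ^ p * ∑' l : ℕ, S2 * b l ^ p := by
        gcongr with l
        exact h2 l
    _ = _ := by rw [ENNReal.tsum_mul_left, mul_assoc]

lemma exponent_le {k l n α q δ : ℝ} (h1 : δ ≤ n * (1 - 1 / q) - α) (h2 : δ ≤ n / q + α) :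
    k * α + (k * n * (1 / q) + (-(max k l * n) + l * n * (1 - 1 / q))) ≤ -(δ * |k - l|) + l * α := by
  have e : n / q = n * (1 / q) := by ring
  rw [e] at h2
  generalize 1 / q = i at *
  rcases le_total k l with h | h
  · rw [max_eq_right h, abs_of_nonpos (by linarith)]
    nlinarith [mul_le_mul_of_nonneg_right h2 (sub_nonneg.2 h)]
  · rw [max_eq_left h, abs_of_nonneg (by linarith)]
    nlinarith [mul_le_mul_of_nonneg_right h1 (sub_nonneg.2 h)]

lemma key_est (n : ℕ) {q α δ : ℝ} {N : (En n → ℝ≥0∞) → ℝ≥0∞} {C : ℝ≥0∞}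
    (hN : SliceProps n q N C) (hδ : 0 < δ)
    (h1 : δ ≤ n * (1 - 1 / q) - α) (h2 : δ ≤ n / q + α) :
    ∃ A : ℝ≥0∞, A ≠ ∞ ∧ ∀ g : En n → ℝ≥0∞, Measurable g → ∀ k : ℕ,
      (2 : ℝ≥0∞) ^ ((k : ℝ) * α) * N ((pieceN n k).indicator (MM n g)) ≤
        A * ∑' l : ℕ, (2 : ℝ≥0∞) ^ (-(δ * |(k : ℝ) - l|)) *
          ((2 : ℝ≥0∞) ^ ((l : ℝ) * α) * N ((pieceN n l).indicator g)) := by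
  obtain ⟨D, hD, hDv⟩ := vol_inv n
  have hC := hN.ne_top
  have hA : C * (C * (C * (C * 2 ^ (|α| + δ) + C * 2 ^ (|α| + δ)) + C * 2 ^ (|α| + δ)) + C * (D * C)) ≠ ∞ := by
    have : (2 : ℝ≥0∞) ^ (|α| + δ) ≠ ∞ := ENNReal.rpow_ne_top_of_nonneg (by positivity) (by simp)
    finiteness
  refine ⟨_, hA, fun g hg k => ?_⟩
  have hgm : ∀ l, Measurable ((pieceN n l).indicator g) := fun l => hg.indicator (meas_piece n l)
  set TT := ∑' l : ℕ, (2 : ℝ≥0∞) ^ (-(δ * |(k : ℝ) - l|)) *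
          ((2 : ℝ≥0∞) ^ ((l : ℝ) * α) * N ((pieceN n l).indicator g)) with hTT
  set c : ℝ≥0∞ := ∑' l : ℕ, (D * (2 : ℝ≥0∞) ^ (-(max (k : ℝ) l * n))) * ∫⁻ y, (pieceN n l).indicator g y with hc
  have hnear : ∀ l : ℕ, |(k : ℝ) - l| ≤ 1 →
      (2 : ℝ≥0∞) ^ ((k : ℝ) * α) * N (MM n ((pieceN n l).indicator g)) ≤ (C * 2 ^ (|α| + δ)) * TT := by
    intro l hl
    calc _ ≤ (2 : ℝ≥0∞) ^ ((k : ℝ) * α) * (C * N ((pieceN n l).indicator g)) := by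
          gcongr; exact hN.max _ (hgm l)
      _ ≤ (2 : ℝ≥0∞) ^ ((|α| + δ) + (-(δ * |(k : ℝ) - l|) + (l : ℝ) * α)) * (C * N ((pieceN n l).indicator g)) := by
          gcongr
          · norm_num
          · have : ((k : ℝ) - l) * α ≤ |α| := by
              calc _ ≤ |((k : ℝ) - l) * α| := le_abs_self _
                _ = |(k : ℝ) - l| * |α| := abs_mul _ _
                _ ≤ 1 * |α| := by gcongr
                _ = _ := one_mul _
            nlinarith
      _ = (C * 2 ^ (|α| + δ)) * ((2 : ℝ≥0∞) ^ (-(δ * |(k : ℝ) - l|)) * ((2 : ℝ≥0∞) ^ ((l : ℝ) * α) * N ((pieceN n l).indicator g))) := by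
          rw [ENNReal.rpow_add (|α| + δ) _ (by simp) (by simp), ENNReal.rpow_add (-(δ * |(k : ℝ) - l|)) _ (by simp) (by simp)]; ring
      _ ≤ _ := by
          gcongr
          exact ENNReal.le_tsum (f := fun l : ℕ => (2 : ℝ≥0∞) ^ (-(δ * |(k : ℝ) - l|)) * ((2 : ℝ≥0∞) ^ ((l : ℝ) * α) * N ((pieceN n l).indicator g))) l
  have hfar : (2 : ℝ≥0∞) ^ ((k : ℝ) * α) * N ((closedBall (0 : En n) (2 ^ k)).indicator fun _ => c) ≤ C * (D * C) * TT := by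
    have hR : ∀ m : ℕ, (1 : ℝ) ≤ 2 ^ m := fun m => one_le_pow₀ (by norm_num)
    calc _ ≤ (2 : ℝ≥0∞) ^ ((k : ℝ) * α) * (C * c * (2 : ℝ≥0∞) ^ ((k : ℝ) * n * (1 / q))) := by
          gcongr
          rw [← two_pow_rpow]
          exact hN.const c _ (hR k)
      _ = ∑' l : ℕ, (2 : ℝ≥0∞) ^ ((k : ℝ) * α) * (C * ((D * (2 : ℝ≥0∞) ^ (-(max (k : ℝ) l * n))) * ∫⁻ y, (pieceN n l).indicator g y) * (2 : ℝ≥0∞) ^ ((k : ℝ) * n * (1 / q))) := by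
          rw [ENNReal.tsum_mul_left, ENNReal.tsum_mul_right, ENNReal.tsum_mul_left]
      _ ≤ ∑' l : ℕ, C * (D * C) * ((2 : ℝ≥0∞) ^ (-(δ * |(k : ℝ) - l|)) * ((2 : ℝ≥0∞) ^ ((l : ℝ) * α) * N ((pieceN n l).indicator g))) := by
          refine ENNReal.tsum_le_tsum fun l => ?_
          have hint : ∫⁻ y, (pieceN n l).indicator g y ≤ C * (2 : ℝ≥0∞) ^ ((l : ℝ) * n * (1 - 1 / q)) * N ((pieceN n l).indicator g) := by
            rw [← two_pow_rpow]
            refine le_trans (le_of_eq ?_) (hN.int _ (hgm l) _ (hR l))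
            symm
            apply setLIntegral_eq_of_support_subset
            intro y hy
            have : y ∈ pieceN n l := by
              by_contra h
              exact hy (indicator_of_notMem h g)
            simpa using piece_le n l this
          calc _ ≤ (2 : ℝ≥0∞) ^ ((k : ℝ) * α) * (C * ((D * (2 : ℝ≥0∞) ^ (-(max (k : ℝ) l * n))) * (C * (2 : ℝ≥0∞) ^ ((l : ℝ) * n * (1 - 1 / q)) * N ((pieceN n l).indicator g))) * (2 : ℝ≥0∞) ^ ((k : ℝ) * n * (1 / q))) := by gcongr
            _ = C * (D * C) * ((2 : ℝ≥0∞) ^ ((k : ℝ) * α + ((k : ℝ) * n * (1 / q) + (-(max (k : ℝ) l * n) + (l : ℝ) * n * (1 - 1 / q)))) * N ((pieceN n l).indicator g)) := by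
                rw [ENNReal.rpow_add _ _ (by simp) (by simp), ENNReal.rpow_add _ _ (by simp) (by simp), ENNReal.rpow_add _ _ (by simp) (by simp)]
                ring
            _ ≤ C * (D * C) * ((2 : ℝ≥0∞) ^ (-(δ * |(k : ℝ) - l|) + (l : ℝ) * α) * N ((pieceN n l).indicator g)) := by
                have he := ENNReal.rpow_le_rpow_of_exponent_le (x := 2) (by norm_num) (exponent_le (k := (k : ℝ)) (l := (l : ℝ)) h1 h2)
                exact mul_le_mul' le_rfl (mul_le_mul' he le_rfl)
            _ = _ := by
                rw [ENNReal.rpow_add _ _ (by simp) (by simp), mul_assoc ((2 : ℝ≥0∞) ^ (-(δ * |(k : ℝ) - l|)))]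
      _ = _ := by rw [ENNReal.tsum_mul_left]
  have hpt : ∀ x, (pieceN n k).indicator (MM n g) x ≤
      MM n ((pieceN n (k - 1)).indicator g) x + MM n ((pieceN n k).indicator g) x +
        MM n ((pieceN n (k + 1)).indicator g) x + (closedBall (0 : En n) (2 ^ k)).indicator (fun _ => c) x := by
    intro x
    by_cases hx : x ∈ pieceN n k
    · have hx' : x ∈ closedBall (0 : En n) (2 ^ k) := by simpa using piece_le n k hx
      rw [indicator_of_mem hx, indicator_of_mem hx']
      refine (MM_le_tsum n g hg x).trans ?_
      refine near_split (fun l => MM n ((pieceN n l).indicator g) x) _ k fun l hl => ?_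
      refine (MM_far n k l hl g hx).trans (le_of_eq ?_)
      rw [hDv]
      push_cast
      rfl
    · rw [indicator_of_notMem hx]; exact zero_le
  have m1 := meas_MM n _ (hgm (k - 1))
  have m2 := meas_MM n _ (hgm k)
  have m3 := meas_MM n _ (hgm (k + 1))
  set w := (2 : ℝ≥0∞) ^ ((k : ℝ) * α) with hw
  have n1 := hnear (k - 1) (by
    rcases Nat.eq_zero_or_pos k with h | h
    · subst h; simp
    · rw [Nat.cast_sub (by omega)]; simp)
  have n2 := hnear k (by simp)
  have n3 := hnear (k + 1) (by simp)
  set f1 := MM n ((pieceN n (k - 1)).indicator g)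
  set f2 := MM n ((pieceN n k).indicator g)
  set f3 := MM n ((pieceN n (k + 1)).indicator g)
  set f4 := (closedBall (0 : En n) (2 ^ k)).indicator (fun _ => c)
  calc w * N ((pieceN n k).indicator (MM n g)) ≤ w * N (fun x => f1 x + f2 x + f3 x + f4 x) := by
        gcongr; exact hN.mono _ _ (Filter.Eventually.of_forall hpt)
    _ ≤ w * (C * (C * (C * (N f1 + N f2) + N f3) + N f4)) := by
        gcongr
        refine (hN.add (fun x => f1 x + f2 x + f3 x) f4 ((m1.add m2).add m3)).trans ?_
        gcongr
        refine (hN.add (fun x => f1 x + f2 x) f3 (m1.add m2)).trans ?_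
        gcongr
        exact hN.add f1 f2 m1
    _ = C * (C * (C * (w * N f1 + w * N f2) + w * N f3) + w * N f4) := by ring
    _ ≤ C * (C * (C * ((C * 2 ^ (|α| + δ)) * TT + (C * 2 ^ (|α| + δ)) * TT) + (C * 2 ^ (|α| + δ)) * TT) + C * (D * C) * TT) := by
        gcongr
    _ = _ := by ring

/-- boundedness of the Hardy–Littlewood maximal operator on the non-homogeneous
Herz-slice space. -/
theorem maximal_bounded_on_nonHomHerzSlice
    (n : ℕ) (hn : 1 ≤ n) (α t r : ℝ) (ht : 0 < t) (hr : 1 < r)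
    (p : ℝ≥0∞) (hp : 0 < p) (hp' : p ≠ ∞)
    (q : ℝ≥0∞) (hq : 1 < q) (hq' : q ≠ ∞)
    (hα₁ : -((n : ℝ) / q.toReal) < α) (hα₂ : α < (n : ℝ) * (1 - 1 / q.toReal)) :
    ∃ C : ℝ≥0, 0 < C ∧ ∀ f : En n → ℂ, LocallyIntegrable f volume →
      herzNonHom n t r q α p (maximal n f) ≤ (C : ℝ≥0∞) * herzNonHomC n t r q α p f := by
  have hq1 : 1 < q.toReal := by
    rw [← ENNReal.toReal_one]; exact (ENNReal.toReal_lt_toReal (by simp) hq').2 hq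
  have hp0 : 0 < p.toReal := ENNReal.toReal_pos hp.ne' hp'
  obtain ⟨C, hN⟩ := sliceProps n ht hr q hq hq'
  set δ := min ((n : ℝ) * (1 - 1 / q.toReal) - α) ((n : ℝ) / q.toReal + α) with hδ
  have hδ0 : 0 < δ := lt_min (by linarith) (by linarith)
  obtain ⟨A, hA, hkey⟩ := key_est n (α := α) hN hδ0 (min_le_left _ _) (min_le_right _ _)
  obtain ⟨S, hS, hseq⟩ := seq_bound hδ0 hp0
  have hpi : 0 ≤ 1 / p.toReal := by positivity
  have hSt : S ^ (1 / p.toReal) ≠ ∞ := ENNReal.rpow_ne_top_of_nonneg hpi hS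
  have hCt : A * S ^ (1 / p.toReal) ≠ ∞ := ENNReal.mul_ne_top hA hSt
  refine ⟨(A * S ^ (1 / p.toReal)).toNNReal + 1, by positivity, fun f hf => ?_⟩
  have hfm : AEMeasurable (fun y => (‖f y‖₊ : ℝ≥0∞)) (volume : Measure (En n)) :=
    hf.aestronglyMeasurable.enorm
  obtain ⟨g, hg, hfg⟩ := hfm
  have hMf : maximal n f = MM n g := by
    ext x
    unfold maximal MM
    refine iSup_congr fun ρ => iSup_congr fun hρ => ?_
    congr 1
    exact lintegral_congr_ae (ae_restrict_of_ae hfg)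
  rw [hMf]
  unfold herzNonHomC herzNonHom
  rw [if_neg hp', if_neg hp']
  have hpiece : ∀ l : ℕ, sliceNorm n t r q ((pieceN n l).indicator g) ≤
      sliceNorm n t r q ((pieceN n l).indicator fun y => (‖f y‖₊ : ℝ≥0∞)) := by
    intro l
    apply hN.mono
    filter_upwards [hfg] with y hy
    by_cases h : y ∈ pieceN n l
    · rw [indicator_of_mem h, indicator_of_mem h, hy]
    · rw [indicator_of_notMem h, indicator_of_notMem h]
  set b : ℕ → ℝ≥0∞ := fun l => (2 : ℝ≥0∞) ^ ((l : ℝ) * α) * sliceNorm n t r q ((pieceN n l).indicator fun y => (‖f y‖₊ : ℝ≥0∞)) with hb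
  calc _ ≤ (∑' k : ℕ, (A * ∑' l : ℕ, (2 : ℝ≥0∞) ^ (-(δ * |(k : ℝ) - l|)) * b l) ^ p.toReal) ^ (1 / p.toReal) := by
        refine ENNReal.rpow_le_rpow (ENNReal.tsum_le_tsum fun k => ENNReal.rpow_le_rpow ?_ hp0.le) hpi
        refine (hkey g hg k).trans ?_
        gcongr with l
        simp only [hb]
        gcongr
        exact hpiece l
    _ = A * (∑' k : ℕ, (∑' l : ℕ, (2 : ℝ≥0∞) ^ (-(δ * |(k : ℝ) - l|)) * b l) ^ p.toReal) ^ (1 / p.toReal) := by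
        simp_rw [ENNReal.mul_rpow_of_nonneg _ _ hp0.le]
        rw [ENNReal.tsum_mul_left, ENNReal.mul_rpow_of_nonneg _ _ hpi, ← ENNReal.rpow_mul A,
          mul_one_div_cancel hp0.ne', ENNReal.rpow_one]
    _ ≤ A * (S * ∑' l, b l ^ p.toReal) ^ (1 / p.toReal) := by
        gcongr
        exact hseq b
    _ = (A * S ^ (1 / p.toReal)) * (∑' l, b l ^ p.toReal) ^ (1 / p.toReal) := by
        rw [ENNReal.mul_rpow_of_nonneg _ _ hpi, mul_assoc]
    _ ≤ _ := by
        gcongr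
        rw [ENNReal.coe_add, ENNReal.coe_toNNReal hCt]
        exact le_self_add
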